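/- For a discrete memoryless source with finite alphabets 𝒳, 𝒴, source distribution P_X with full support, and conditional distribution P_{Y|X}, the pair (R, P_{Y|X}) is achievable by coordination codes if and only if R ≥ I(X;Y), where I(X;Y) is the mutual information under P_{XY} = P_X P_{Y|X}. -/

import Mathlib

open scoped BigOperators ENNReal Classical
open Filter

section InformationDefs

variable {α X Y : Type*}

/-- A probability mass function on a finite alphabet. -/
def IsPMF [Fintype α] (P : α → ℝ) : Prop :=
  (∀ a, 0 ≤ P a) ∧ ∑ a, P a = 1

/-- Variational distance `‖P − Q‖ = sup_A |P(A) − Q(A)|` on a finite alphabet. -/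
noncomputable def tvDist [Fintype α] (P Q : α → ℝ) : ℝ :=
  Finset.univ.powerset.sup' ⟨∅, Finset.empty_mem_powerset _⟩
    fun A => |∑ a ∈ A, P a - ∑ a ∈ A, Q a|

/-- Relative entropy `D(P‖Q) = ∑ P log(P/Q)` on a finite alphabet, infinite when
`P` is not absolutely continuous with respect to `Q`. -/
noncomputable def relEnt [Fintype α] (P Q : α → ℝ) : ℝ≥0∞ :=
  if ∀ a, Q a = 0 → P a = 0 then
    ENNReal.ofReal (∑ a, P a * Real.log (P a / Q a))
  else ⊤

/-- Shannon entropy on a finite alphabet. -/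
noncomputable def entropy [Fintype α] (P : α → ℝ) : ℝ :=
  -∑ a, P a * Real.log (P a)

/-- First (X-) marginal of a joint distribution. -/
noncomputable def margX [Fintype Y] (P : X × Y → ℝ) : X → ℝ :=
  fun x => ∑ y, P (x, y)

/-- Second (Y-) marginal of a joint distribution. -/
noncomputable def margY [Fintype X] (P : X × Y → ℝ) : Y → ℝ :=
  fun y => ∑ x, P (x, y)

/-- Backward conditional distribution `P_{X|Y}(x|y) = P(x,y)/P_Y(y)`. -/
noncomputable def condXY [Fintype X] (P : X × Y → ℝ) : X → Y → ℝ :=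
  fun x y => P (x, y) / margY P y

/-- Forward conditional distribution `P_{Y|X}(y|x) = P(x,y)/P_X(x)`. -/
noncomputable def condYX [Fintype Y] (P : X × Y → ℝ) : Y → X → ℝ :=
  fun y x => P (x, y) / margX P x

/-- Mutual information `I(X;Y)` of a joint distribution on a finite product alphabet. -/
noncomputable def mutualInfo [Fintype X] [Fintype Y] (P : X × Y → ℝ) : ℝ :=
  ∑ x, ∑ y, P (x, y) * Real.log (P (x, y) / (margX P x * margY P y))

/-- A block code of length `n`: an encoder into `{1,…,M}` and a decoder. -/
structure Code (X Y : Type*) (n : ℕ) where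
  M : ℕ
  hM : 0 < M
  enc : (Fin n → X) → Fin M
  dec : Fin M → Fin n → Y

/-- Rate `R_n = (1/n) log M` of a code. -/
noncomputable def Code.rate {X Y : Type*} {n : ℕ} (c : Code X Y n) : ℝ :=
  Real.log c.M / n

/-- The reconstruction sequence `Yⁿ = g_n(f_n(xⁿ))` produced by a code. -/
def Code.out {X Y : Type*} {n : ℕ} (c : Code X Y n) (xs : Fin n → X) : Fin n → Y :=
  c.dec (c.enc xs)

/-- The i.i.d. (memoryless) source distribution on `n`-blocks. -/
noncomputable def iid (PX : X → ℝ) (n : ℕ) : (Fin n → X) → ℝ :=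
  fun xs => ∏ i, PX (xs i)

/-- The code-induced joint distribution
`P_{XⁿYⁿ}(xⁿ,yⁿ) = ∏ P_X(x_i) · 1{yⁿ = g_n(f_n(xⁿ))}`. -/
noncomputable def inducedJoint [DecidableEq Y] (PX : X → ℝ) {n : ℕ} (c : Code X Y n) :
    (Fin n → X) × (Fin n → Y) → ℝ :=
  fun p => (∏ i, PX (p.1 i)) * (if p.2 = c.out p.1 then 1 else 0)

/-- The approximating joint distribution
`Q_{XⁿYⁿ}(xⁿ,yⁿ) = (|g_n⁻¹(yⁿ)|/M) · ∏ P_{X|Y}(x_i|y_i)`: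
a uniformly chosen codeword passed through the backward memoryless channel. -/
noncomputable def approxJoint [Fintype X] [DecidableEq Y] (PXY : X × Y → ℝ) {n : ℕ}
    (c : Code X Y n) : (Fin n → X) × (Fin n → Y) → ℝ :=
  fun p => (((Finset.univ.filter fun m => c.dec m = p.2).card : ℝ) / c.M) *
    ∏ i, condXY PXY (p.1 i) (p.2 i)

/-- The uniform distribution over the codebook, `Q_{Yⁿ}(yⁿ) = |g_n⁻¹(yⁿ)|/M`. -/
noncomputable def codebookUniform [DecidableEq Y] {n : ℕ} (c : Code X Y n) :
    (Fin n → Y) → ℝ :=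
  fun ys => ((Finset.univ.filter fun m => c.dec m = ys).card : ℝ) / c.M

/-- The empirical (joint type) distribution of a pair of sequences. -/
noncomputable def empDist [DecidableEq X] [DecidableEq Y] {n : ℕ}
    (xs : Fin n → X) (ys : Fin n → Y) : X × Y → ℝ :=
  fun p => ((Finset.univ.filter fun i => xs i = p.1 ∧ ys i = p.2).card : ℝ) / n

/-- `‖T_{XⁿYⁿ} − P_{XY}‖ → 0` in probability under the i.i.d. source. -/
def TVInProb [Fintype X] [Fintype Y] [DecidableEq X] [DecidableEq Y]
    (PX : X → ℝ) (PXY : X × Y → ℝ) (c : ∀ n, Code X Y n) : Prop :=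
  ∀ ε : ℝ, 0 < ε →
    Tendsto (fun n => ∑ xs : Fin n → X,
        if ε < tvDist (empDist xs ((c n).out xs)) PXY then iid PX n xs else 0)
      atTop (nhds 0)

/-- A good sequence of coordination codes for `P_{Y|X}` (specified via the joint `PXY`):
the rates converge to `I(X;Y)` and the empirical distribution converges to `PXY`
in variational distance, in probability. -/
def GoodCoord [Fintype X] [Fintype Y] [DecidableEq X] [DecidableEq Y]
    (PX : X → ℝ) (PXY : X × Y → ℝ) (c : ∀ n, Code X Y n) : Prop :=
  Tendsto (fun n => (c n).rate) atTop (nhds (mutualInfo PXY)) ∧ TVInProb PX PXY c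

end InformationDefs
/-- A pair `(R, P_{Y|X})` is achievable if there is a sequence of coordination codes
with rates converging to `R` whose empirical distributions converge to
`P_{XY} = P_X P_{Y|X}` in variational distance, in probability. -/
def CoordAchievable {X Y : Type*} [Fintype X] [Fintype Y] [DecidableEq X] [DecidableEq Y]
    (PX : X → ℝ) (PXY : X × Y → ℝ) (R : ℝ) : Prop :=
  ∃ c : ∀ n, Code X Y n,
    Tendsto (fun n => (c n).rate) atTop (nhds R) ∧ TVInProb PX PXY c

/-- A sum over all words of a product over letters factors. -/
lemma sum_words_prod {Z : Type*} [Fintype Z] {n : ℕ} (f : Fin n → Z → ℝ) :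
    ∑ z : Fin n → Z, ∏ i, f i (z i) = ∏ i, ∑ a, f i a := by
  classical
  rw [Finset.prod_univ_sum, Fintype.piFinset_univ]

lemma abs_sub_le_tvDist {Z : Type*} [Fintype Z] (P Q : Z → ℝ) (a : Z) :
    |P a - Q a| ≤ tvDist P Q := by
  have h := Finset.le_sup' (s := Finset.univ.powerset)
    (fun A : Finset Z => |∑ a ∈ A, P a - ∑ a ∈ A, Q a|)
    (Finset.mem_powerset.2 (Finset.subset_univ {a}))
  simpa [tvDist] using h

lemma tvDist_le_sum_abs {Z : Type*} [Fintype Z] (P Q : Z → ℝ) :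
    tvDist P Q ≤ ∑ a, |P a - Q a| := by
  refine Finset.sup'_le _ _ fun A _ => ?_
  rw [← Finset.sum_sub_distrib]
  exact (Finset.abs_sum_le_sum_abs _ _).trans
    (Finset.sum_le_sum_of_subset_of_nonneg (Finset.subset_univ A) fun _ _ _ => abs_nonneg _)

lemma abs_sum_mul_sub_le {Z : Type*} [Fintype Z] (P Q φ : Z → ℝ) {ε : ℝ}
    (h : tvDist P Q ≤ ε) :
    |∑ a, P a * φ a - ∑ a, Q a * φ a| ≤ (∑ a, |φ a|) * ε := by
  rw [← Finset.sum_sub_distrib, Finset.sum_mul]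
  refine (Finset.abs_sum_le_sum_abs _ _).trans (Finset.sum_le_sum fun a _ => ?_)
  rw [← sub_mul, abs_mul, mul_comm]
  exact mul_le_mul_of_nonneg_left ((abs_sub_le_tvDist P Q a).trans h) (abs_nonneg _)

lemma mul_sum_empDist_mul {X Y : Type*} [Fintype X] [Fintype Y] [DecidableEq X] [DecidableEq Y]
    {n : ℕ} (xs : Fin n → X) (ys : Fin n → Y) (φ : X × Y → ℝ) :
    n * ∑ p, empDist xs ys p * φ p = ∑ i, φ (xs i, ys i) := by
  rcases Nat.eq_zero_or_pos n with rfl | hn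
  · simp
  have hn' : (n : ℝ) ≠ 0 := by positivity
  have h1 : ∀ p, (n : ℝ) * (empDist xs ys p * φ p) =
      ∑ i, if p = (xs i, ys i) then φ p else 0 := by
    intro p
    rw [empDist, ← mul_assoc, mul_div_cancel₀ _ hn', Finset.card_filter, Nat.cast_sum,
      Finset.sum_mul]
    refine Finset.sum_congr rfl fun i _ => ?_
    by_cases h : p = (xs i, ys i)
    · simp [h]
    · rw [if_neg h, if_neg]
      · simp
      · rintro ⟨h1, h2⟩
        exact h (Prod.ext h1.symm h2.symm)
  rw [Finset.mul_sum, Finset.sum_congr rfl fun p _ => h1 p, Finset.sum_comm]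
  simp

/-- Letter averages along a pair of words close in type to `P` are close to their `P`-mean. -/
lemma abs_sum_letters_sub_le {X Y : Type*} [Fintype X] [Fintype Y] [DecidableEq X]
    [DecidableEq Y] {n : ℕ} (xs : Fin n → X) (ys : Fin n → Y) (P φ : X × Y → ℝ) {ε : ℝ}
    (h : tvDist (empDist xs ys) P ≤ ε) :
    |∑ i, φ (xs i, ys i) - n * ∑ p, P p * φ p| ≤ n * ((∑ p, |φ p|) * ε) := by
  rw [← mul_sum_empDist_mul, ← mul_sub, abs_mul, Nat.abs_cast]
  exact mul_le_mul_of_nonneg_left (abs_sum_mul_sub_le _ _ _ h) n.cast_nonneg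

lemma sum_mul_exp_le {Z : Type*} [Fintype Z] {P h : Z → ℝ} (hP : IsPMF P)
    (hh : ∀ a, |h a| ≤ 1) (h0 : ∑ a, P a * h a = 0) {t : ℝ} (ht : |t| ≤ 1) :
    ∑ a, P a * Real.exp (t * h a) ≤ Real.exp (t ^ 2) := by
  have key : ∀ a, P a * Real.exp (t * h a) ≤ P a * (1 + t ^ 2) + t * (P a * h a) := by
    intro a
    have h1 : |t * h a| ≤ 1 := by
      rw [abs_mul]; exact mul_le_one₀ ht (abs_nonneg _) (hh a)
    have h2 := (abs_le.1 (Real.abs_exp_sub_one_sub_id_le h1)).2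
    have h3 : (t * h a) ^ 2 ≤ t ^ 2 := by
      rw [mul_pow]
      exact mul_le_of_le_one_right (sq_nonneg _) (by rw [← sq_abs]; exact pow_le_one₀ (abs_nonneg _) (hh a))
    nlinarith [hP.1 a]
  refine (Finset.sum_le_sum fun a _ => key a).trans ?_
  rw [Finset.sum_add_distrib, ← Finset.sum_mul, ← Finset.mul_sum, h0, hP.2]
  linarith [Real.add_one_le_exp (t ^ 2)]

lemma sum_words_exp_le {Z : Type*} [Fintype Z] {P h : Z → ℝ} (hP : IsPMF P)
    (hh : ∀ a, |h a| ≤ 1) (h0 : ∑ a, P a * h a = 0) {t : ℝ} (ht : |t| ≤ 1) (n : ℕ) :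
    ∑ z : Fin n → Z, (∏ i, P (z i)) * Real.exp (t * ∑ i, h (z i)) ≤ Real.exp (n * t ^ 2) := by
  have h1 : ∀ z : Fin n → Z, (∏ i, P (z i)) * Real.exp (t * ∑ i, h (z i)) =
      ∏ i, P (z i) * Real.exp (t * h (z i)) := by
    intro z
    rw [Finset.mul_sum, Real.exp_sum, Finset.prod_mul_distrib]
  rw [Finset.sum_congr rfl fun z _ => h1 z,
    sum_words_prod (fun (_ : Fin n) a => P a * Real.exp (t * h a)), Finset.prod_const,
    Finset.card_univ, Fintype.card_fin, Real.exp_nat_mul]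
  exact pow_le_pow_left₀ (Finset.sum_nonneg fun a _ => mul_nonneg (hP.1 a) (Real.exp_pos _).le)
    (sum_mul_exp_le hP hh h0 ht) n

/-- The joint type of i.i.d. pairs concentrates exponentially around their distribution. -/
lemma sum_words_tvDist_gt_le {X Y : Type*} [Fintype X] [Fintype Y] [DecidableEq X]
    [DecidableEq Y] {P : X × Y → ℝ} (hP : IsPMF P) {ε : ℝ} (hε : 0 ≤ ε) (hε1 : ε ≤ 1) (n : ℕ) :
    ∑ z : Fin n → X × Y, (∏ i, P (z i)) *
        (if ε < tvDist (empDist (fun i => (z i).1) (fun i => (z i).2)) P then 1 else 0) ≤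
      Fintype.card (X × Y) *
        (2 * Real.exp (-(n * ε ^ 2 / (4 * Fintype.card (X × Y) ^ 2)))) := by
  set k : ℝ := (Fintype.card (X × Y) : ℝ) with hk
  have hne : Nonempty (X × Y) := by
    by_contra hne
    rw [not_nonempty_iff] at hne
    simpa using hP.2
  have hk1 : 1 ≤ k := by
    rw [hk]; exact_mod_cast Fintype.card_pos
  set h : X × Y → X × Y → ℝ := fun a z => (if z = a then 1 else 0) - P a with hh
  have hPle : ∀ a, P a ≤ 1 := fun a =>
    hP.2 ▸ Finset.single_le_sum (fun b _ => hP.1 b) (Finset.mem_univ a)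
  have habs : ∀ a z, |h a z| ≤ 1 := by
    intro a z
    have := hP.1 a
    have := hPle a
    simp only [hh]
    split_ifs <;> rw [abs_le] <;> constructor <;> linarith
  have hmean : ∀ a, ∑ z, P z * h a z = 0 := by
    intro a
    simp [hh, mul_sub, Finset.sum_sub_distrib, ← Finset.sum_mul, hP.2]
  set t : ℝ := ε / (2 * k) with ht
  have ht0 : 0 ≤ t := by positivity
  have ht1 : t ≤ 1 := by rw [ht, div_le_one (by positivity)]; linarith
  have hpt : ∀ z : Fin n → X × Y,
      (if ε < tvDist (empDist (fun i => (z i).1) (fun i => (z i).2)) P then (1 : ℝ) else 0) ≤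
      ∑ a, (Real.exp (t * ∑ i, h a (z i)) + Real.exp (-t * ∑ i, h a (z i))) *
        Real.exp (-(t * (n * (ε / k)))) := by
    intro z
    have hnn : ∀ a ∈ Finset.univ, 0 ≤ (Real.exp (t * ∑ i, h a (z i)) +
        Real.exp (-t * ∑ i, h a (z i))) * Real.exp (-(t * (n * (ε / k)))) :=
      fun a _ => by positivity
    split_ifs with hz
    swap
    · exact Finset.sum_nonneg hnn
    set T := empDist (fun i => (z i).1) (fun i => (z i).2) with hT
    obtain ⟨a, -, ha⟩ : ∃ a ∈ Finset.univ, ε / k < |T a - P a| := by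
      apply Finset.exists_lt_of_sum_lt
      rw [Finset.sum_const, Finset.card_univ, nsmul_eq_mul, ← hk, mul_div_cancel₀ _ (by positivity)]
      exact hz.trans_le (tvDist_le_sum_abs _ _)
    have hsum : ∑ i, h a (z i) = n * (T a - P a) := by
      have := mul_sum_empDist_mul (fun i => (z i).1) (fun i => (z i).2)
        (fun p => if p = a then (1 : ℝ) else 0)
      simp only [mul_ite, mul_one, mul_zero, Finset.sum_ite_eq', Finset.mem_univ, if_true,
        Prod.mk.eta] at this
      simp only [hh, Finset.sum_sub_distrib, Finset.sum_const, Finset.card_univ,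
        Fintype.card_fin, nsmul_eq_mul, ← this]
      ring
    refine le_trans ?_ (Finset.single_le_sum hnn (Finset.mem_univ a))
    rw [hsum, add_mul, ← Real.exp_add, ← Real.exp_add]
    have htn : 0 ≤ t * n := by positivity
    rcases lt_abs.1 ha with h1 | h1
    · have : 0 ≤ t * (n * (T a - P a)) + -(t * (n * (ε / k))) := by nlinarith
      linarith [Real.one_le_exp this, Real.exp_pos (-t * (n * (T a - P a)) + -(t * (n * (ε / k))))]
    · have : 0 ≤ -t * (n * (T a - P a)) + -(t * (n * (ε / k))) := by nlinarith
      linarith [Real.one_le_exp this, Real.exp_pos (t * (n * (T a - P a)) + -(t * (n * (ε / k))))]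
  have hw : ∀ z : Fin n → X × Y, 0 ≤ ∏ i, P (z i) := fun z =>
    Finset.prod_nonneg fun i _ => hP.1 _
  refine (Finset.sum_le_sum fun z _ => mul_le_mul_of_nonneg_left (hpt z) (hw z)).trans ?_
  simp_rw [Finset.mul_sum (Finset.univ : Finset (X × Y))]
  have hconst (r : ℝ) : k * r = ∑ _a : X × Y, r := by simp [hk]
  rw [Finset.sum_comm, hconst]
  refine Finset.sum_le_sum fun a _ => ?_
  set E := Real.exp (-(t * (n * (ε / k)))) with hE
  simp_rw [← mul_assoc, mul_add]
  rw [← Finset.sum_mul, Finset.sum_add_distrib]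
  have e1 := sum_words_exp_le hP (habs a) (hmean a) (t := t) (abs_le.2 ⟨by linarith, ht1⟩) n
  have e2 := sum_words_exp_le hP (habs a) (hmean a) (t := -t) (abs_le.2 ⟨by linarith, by linarith⟩) n
  rw [neg_sq] at e2
  have e3 : Real.exp (-(n * ε ^ 2 / (4 * k ^ 2))) =
      Real.exp (n * t ^ 2) * E := by
    rw [hE, ← Real.exp_add, ht]
    congr 1
    field_simp
    ring
  rw [e3, ← mul_assoc]
  simp only [neg_mul] at e2 ⊢
  exact mul_le_mul_of_nonneg_right (by linarith) (Real.exp_pos _).le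

lemma IsPMF.sum_mul_ite_not {Z : Type*} [Fintype Z] {P : Z → ℝ} (hP : IsPMF P) (E : Z → Prop) :
    ∑ a, P a * (if E a then 0 else 1) = 1 - ∑ a, P a * (if E a then 1 else 0) := by
  rw [eq_sub_iff_add_eq, ← Finset.sum_add_distrib]
  refine Eq.trans ?_ hP.2
  exact Finset.sum_congr rfl fun a _ => by split_ifs <;> ring

/-- One-shot covering by random coding: if `K a b ≤ L * Q b` whenever `a` and `b` are compatible,
then some codebook of size `M` leaves uncovered little more than the incompatible mass. -/
lemma exists_codebook {A B : Type*} [Fintype A] [Fintype B] {P : A → ℝ} {Q : B → ℝ}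
    {K : A → B → ℝ} (hP : IsPMF P) (hQ : IsPMF Q) (hK : ∀ a, IsPMF (K a)) (G : A → B → Prop)
    {L : ℝ} (hL : 0 < L) (hG : ∀ a b, G a b → K a b ≤ L * Q b) (M : ℕ) :
    ∃ b : Fin M → B, ∑ a, P a * (if ∀ m, ¬ G a (b m) then 1 else 0) ≤
      ∑ a, P a * ∑ b, K a b * (if G a b then 0 else 1) + Real.exp (-(M / L)) := by
  classical
  set rhs := ∑ a, P a * ∑ b, K a b * (if G a b then 0 else 1) + Real.exp (-(M / L)) with hrhs
  have hw : ∑ b : Fin M → B, ∏ m, Q (b m) = 1 := by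
    rw [sum_words_prod (fun _ => Q)]; simp [hQ.2]
  have hcover : ∀ a, (∑ b, Q b * (if G a b then 0 else 1)) ^ M ≤
      ∑ b, K a b * (if G a b then 0 else 1) + Real.exp (-(M / L)) := by
    intro a
    set κ := ∑ b, K a b * (if G a b then 1 else 0) with hκ
    have hκ' : ∑ b, K a b * (if G a b then 0 else 1) = 1 - κ := by
      rw [hκ, (hK a).sum_mul_ite_not]
    have hκ0 : 0 ≤ κ := Finset.sum_nonneg fun b _ =>
      mul_nonneg ((hK a).1 b) (by split_ifs <;> norm_num)
    have hκ1 : 0 ≤ 1 - κ := by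
      rw [← hκ']
      exact Finset.sum_nonneg fun b _ => mul_nonneg ((hK a).1 b) (by split_ifs <;> norm_num)
    have hq : ∑ b, Q b * (if G a b then 0 else 1) ≤ 1 - κ / L := by
      have h1 : κ / L ≤ ∑ b, Q b * (if G a b then 1 else 0) := by
        rw [hκ, Finset.sum_div]
        refine Finset.sum_le_sum fun b _ => ?_
        split_ifs with hb
        · rw [mul_one, mul_one, div_le_iff₀ hL, mul_comm]
          exact hG a b hb
        · simp
      have h2 : ∑ b, Q b * (if G a b then 0 else 1) =
          1 - ∑ b, Q b * (if G a b then 1 else 0) :=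
        hQ.sum_mul_ite_not _
      linarith
    have hq0 : 0 ≤ ∑ b, Q b * (if G a b then 0 else 1) :=
      Finset.sum_nonneg fun b _ => mul_nonneg (hQ.1 b) (by split_ifs <;> norm_num)
    have hexp : ∑ b, Q b * (if G a b then 0 else 1) ≤ Real.exp (-(κ / L)) := by
      linarith [Real.add_one_le_exp (-(κ / L))]
    have hconv := convexOn_exp.2 (Set.mem_univ 0) (Set.mem_univ (-(M / L))) hκ1 hκ0 (by ring)
    simp only [smul_eq_mul, mul_zero, zero_add, Real.exp_zero, mul_one] at hconv
    calc _ ≤ Real.exp (-(κ / L)) ^ M := pow_le_pow_left₀ hq0 hexp M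
      _ = Real.exp (κ * -(M / L)) := by rw [← Real.exp_nat_mul]; congr 1; ring
      _ ≤ (1 - κ) + κ * Real.exp (-(M / L)) := hconv
      _ ≤ _ := by
        rw [hκ']
        have := mul_le_of_le_one_left (Real.exp_pos (-(M / L))).le (sub_nonneg.1 hκ1)
        linarith
  have havg : ∑ b : Fin M → B, (∏ m, Q (b m)) *
      ∑ a, P a * (if ∀ m, ¬ G a (b m) then 1 else 0) ≤ rhs := by
    simp_rw [Finset.mul_sum]
    rw [Finset.sum_comm]
    have h1 : ∀ a, ∑ b : Fin M → B, (∏ m, Q (b m)) *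
        (P a * (if ∀ m, ¬ G a (b m) then 1 else 0)) =
        P a * (∑ b, Q b * (if G a b then 0 else 1)) ^ M := by
      intro a
      have h2 := sum_words_prod (fun (_ : Fin M) b => Q b * (if G a b then (0 : ℝ) else 1))
      rw [Finset.prod_const, Finset.card_univ, Fintype.card_fin] at h2
      rw [← h2, Finset.mul_sum]
      refine Finset.sum_congr rfl fun b _ => ?_
      rw [Finset.prod_mul_distrib, mul_left_comm]
      congr 2
      split_ifs with hb
      · exact (Finset.prod_eq_one fun m _ => if_neg (hb m)).symm
      · push Not at hb
        obtain ⟨m, hm⟩ := hb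
        rw [Finset.prod_eq_zero (Finset.mem_univ m) (by rw [if_pos hm])]
    rw [Finset.sum_congr rfl fun a _ => h1 a]
    refine (Finset.sum_le_sum fun a _ => mul_le_mul_of_nonneg_left (hcover a) (hP.1 a)).trans ?_
    simp_rw [mul_add]
    rw [Finset.sum_add_distrib, ← Finset.sum_mul, hP.2, one_mul]
  by_contra! hcon
  have hlt : ∑ b : Fin M → B, (∏ m, Q (b m)) * rhs <
      ∑ b : Fin M → B, (∏ m, Q (b m)) * ∑ a, P a * (if ∀ m, ¬ G a (b m) then 1 else 0) := by
    have hpos : ∃ b : Fin M → B, 0 < ∏ m, Q (b m) := by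
      by_contra! hnp
      have := Finset.sum_nonpos fun b (_ : b ∈ Finset.univ) => hnp b
      linarith
    obtain ⟨b, hb⟩ := hpos
    exact Finset.sum_lt_sum
      (fun b _ => mul_le_mul_of_nonneg_left (hcon b).le (Finset.prod_nonneg fun m _ => hQ.1 _))
      ⟨b, Finset.mem_univ b, mul_lt_mul_of_pos_left (hcon b) hb⟩
  rw [← Finset.sum_mul, hw, one_mul] at hlt
  linarith

lemma isPMF_prod {Z : Type*} [Fintype Z] {n : ℕ} {P : Fin n → Z → ℝ} (hP : ∀ i, IsPMF (P i)) :
    IsPMF fun z : Fin n → Z => ∏ i, P i (z i) :=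
  ⟨fun _ => Finset.prod_nonneg fun i _ => (hP i).1 _, by
    rw [sum_words_prod]; exact Finset.prod_eq_one fun i _ => (hP i).2⟩

section JointPMF

variable {X Y : Type*} [Fintype X] [Fintype Y] {P : X × Y → ℝ}

lemma isPMF_margX (hP : IsPMF P) : IsPMF (margX P) :=
  ⟨fun _ => Finset.sum_nonneg fun _ _ => hP.1 _, by
    rw [← hP.2, Fintype.sum_prod_type]; rfl⟩

lemma isPMF_margY (hP : IsPMF P) : IsPMF (margY P) :=
  ⟨fun _ => Finset.sum_nonneg fun _ _ => hP.1 _, by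
    rw [← hP.2, Fintype.sum_prod_type_right]; rfl⟩

lemma le_margX (hP : IsPMF P) (p : X × Y) : P p ≤ margX P p.1 :=
  Finset.single_le_sum (f := fun y => P (p.1, y)) (fun _ _ => hP.1 _) (Finset.mem_univ p.2)

lemma le_margY (hP : IsPMF P) (p : X × Y) : P p ≤ margY P p.2 :=
  Finset.single_le_sum (f := fun x => P (x, p.2)) (fun _ _ => hP.1 _) (Finset.mem_univ p.1)

lemma marg_mul_pos (hP : IsPMF P) {p : X × Y} (hp : 0 < P p) :
    0 < margX P p.1 * margY P p.2 :=
  mul_pos (hp.trans_le (le_margX hP p)) (hp.trans_le (le_margY hP p))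

/-- The likelihood ratio of a joint distribution against the product of its marginals. -/
noncomputable def likelihoodRatio (P : X × Y → ℝ) (p : X × Y) : ℝ :=
  P p / (margX P p.1 * margY P p.2)

lemma likelihoodRatio_nonneg (hP : IsPMF P) (p : X × Y) : 0 ≤ likelihoodRatio P p :=
  div_nonneg (hP.1 p) (mul_nonneg ((isPMF_margX hP).1 _) ((isPMF_margY hP).1 _))

lemma likelihoodRatio_pos (hP : IsPMF P) {p : X × Y} (hp : 0 < P p) : 0 < likelihoodRatio P p :=
  div_pos hp (marg_mul_pos hP hp)

lemma mutualInfo_eq_sum (P : X × Y → ℝ) :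
    mutualInfo P = ∑ p, P p * Real.log (likelihoodRatio P p) := by
  rw [Fintype.sum_prod_type]; rfl

lemma mutualInfo_nonneg (hP : IsPMF P) : 0 ≤ mutualInfo P := by
  have h : ∀ p, P p - margX P p.1 * margY P p.2 ≤ P p * Real.log (likelihoodRatio P p) := by
    intro p
    rcases (hP.1 p).eq_or_lt with h0 | hpos
    · rw [← h0]
      have := mul_nonneg ((isPMF_margX hP).1 p.1) ((isPMF_margY hP).1 p.2)
      linarith
    · have h1 := Real.one_sub_inv_le_log_of_pos (likelihoodRatio_pos hP hpos)
      calc _ = P p * (1 - (likelihoodRatio P p)⁻¹) := by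
            rw [likelihoodRatio, inv_div]; field_simp
        _ ≤ _ := mul_le_mul_of_nonneg_left h1 hpos.le
  rw [mutualInfo_eq_sum]
  refine le_trans (le_of_eq ?_) (Finset.sum_le_sum fun p _ => h p)
  rw [Finset.sum_sub_distrib, hP.2, Fintype.sum_prod_type]
  simp_rw [← Finset.mul_sum]
  rw [(isPMF_margY hP).2]
  simp [(isPMF_margX hP).2]

lemma sum_margX_mul_likelihoodRatio_le (hP : IsPMF P) (y : Y) :
    ∑ x, margX P x * likelihoodRatio P (x, y) ≤ 1 := by
  have h : ∀ x, margX P x * likelihoodRatio P (x, y) ≤ P (x, y) / margY P y := by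
    intro x
    rcases ((isPMF_margX hP).1 x).eq_or_lt with h0 | hpos
    · rw [← h0, zero_mul]
      exact div_nonneg (hP.1 _) ((isPMF_margY hP).1 y)
    · refine le_of_eq ?_
      rw [likelihoodRatio]
      dsimp only
      field_simp
  refine (Finset.sum_le_sum fun x _ => h x).trans ?_
  rw [← Finset.sum_div]
  exact div_self_le_one _

lemma mutualInfo_le_sum_log_add (hP : IsPMF P) {η : ℝ} (hη : 0 < η) :
    mutualInfo P ≤ ∑ p, P p * Real.log (likelihoodRatio P p + η) := by
  rw [mutualInfo_eq_sum]
  refine Finset.sum_le_sum fun p _ => ?_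
  rcases (hP.1 p).eq_or_lt with h0 | hpos
  · simp [← h0]
  · exact mul_le_mul_of_nonneg_left
      (Real.log_le_log (likelihoodRatio_pos hP hpos) (by linarith)) hpos.le

variable [DecidableEq X] [DecidableEq Y]

/-- The source probability that a fixed reconstruction word has joint type close to `P` is
exponentially small with exponent close to the mutual information. -/
lemma sum_iid_tvDist_le (hP : IsPMF P) {η : ℝ} (hη : 0 < η) {ε : ℝ} {n : ℕ} (ys : Fin n → Y) :
    ∑ xs : Fin n → X, iid (margX P) n xs * (if tvDist (empDist xs ys) P ≤ ε then 1 else 0) ≤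
      Real.exp (n * (η + (∑ p, |Real.log (likelihoodRatio P p + η)|) * ε - mutualInfo P)) := by
  set g : X × Y → ℝ := fun p => likelihoodRatio P p + η with hg
  set C := ∑ p, |Real.log (g p)| with hC
  have hgpos : ∀ p, 0 < g p := fun p => add_pos_of_nonneg_of_pos (likelihoodRatio_nonneg hP p) hη
  have hmX := isPMF_margX hP
  have hpt : ∀ xs : Fin n → X, (if tvDist (empDist xs ys) P ≤ ε then (1 : ℝ) else 0) ≤
      (∏ i, g (xs i, ys i)) * Real.exp (n * (C * ε - mutualInfo P)) := by
    intro xs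
    have hprod : ∏ i, g (xs i, ys i) = Real.exp (∑ i, Real.log (g (xs i, ys i))) := by
      rw [Real.exp_sum]
      exact Finset.prod_congr rfl fun i _ => (Real.exp_log (hgpos _)).symm
    rw [hprod, ← Real.exp_add]
    split_ifs with h
    swap
    · exact (Real.exp_pos _).le
    refine Real.one_le_exp ?_
    have h1 := (abs_le.1 (abs_sum_letters_sub_le xs ys P (fun p => Real.log (g p)) h)).1
    have h2 := mul_le_mul_of_nonneg_left (mutualInfo_le_sum_log_add hP hη) (n.cast_nonneg (α := ℝ))
    rw [mul_sub]
    linarith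
  have hsum : ∑ xs : Fin n → X, iid (margX P) n xs * ∏ i, g (xs i, ys i) ≤ Real.exp (n * η) := by
    simp_rw [iid, ← Finset.prod_mul_distrib]
    rw [sum_words_prod (fun i x => margX P x * g (x, ys i)), Real.exp_nat_mul]
    refine (Finset.prod_le_prod (fun i _ => Finset.sum_nonneg fun x _ =>
      mul_nonneg (hmX.1 x) (hgpos _).le) (g := fun _ => Real.exp η) fun i _ => ?_).trans
      (by simp)
    simp_rw [hg, mul_add]
    rw [Finset.sum_add_distrib, ← Finset.sum_mul, hmX.2, one_mul]
    linarith [sum_margX_mul_likelihoodRatio_le hP (ys i), Real.add_one_le_exp η]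
  calc _ ≤ ∑ xs : Fin n → X, iid (margX P) n xs *
        ((∏ i, g (xs i, ys i)) * Real.exp (n * (C * ε - mutualInfo P))) :=
        Finset.sum_le_sum fun xs _ => mul_le_mul_of_nonneg_left (hpt xs)
          (Finset.prod_nonneg fun i _ => hmX.1 _)
    _ = (∑ xs : Fin n → X, iid (margX P) n xs * ∏ i, g (xs i, ys i)) *
        Real.exp (n * (C * ε - mutualInfo P)) := by
      rw [Finset.sum_mul (Finset.univ : Finset (Fin n → X))]
      exact Finset.sum_congr rfl fun _ _ => (mul_assoc _ _ _).symm
    _ ≤ Real.exp (n * η) * Real.exp (n * (C * ε - mutualInfo P)) :=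
      mul_le_mul_of_nonneg_right hsum (Real.exp_pos _).le
    _ = _ := by rw [← Real.exp_add]; congr 1; ring

/-- The source probability that a code reproduces a joint type close to `P`. -/
lemma one_sub_le_code_size_mul (hP : IsPMF P) {η : ℝ} (hη : 0 < η) {ε : ℝ} {n : ℕ}
    (c : Code X Y n) :
    1 - ∑ xs : Fin n → X,
        (if ε < tvDist (empDist xs (c.out xs)) P then iid (margX P) n xs else 0) ≤
      c.M * Real.exp (n * (η + (∑ p, |Real.log (likelihoodRatio P p + η)|) * ε -
        mutualInfo P)) := by
  have hiid : IsPMF (iid (margX P) n) := isPMF_prod fun _ => isPMF_margX hP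
  have h1 : ∑ _m : Fin c.M, Real.exp (n * (η + (∑ p, |Real.log (likelihoodRatio P p + η)|) * ε -
      mutualInfo P)) = c.M * Real.exp (n * (η +
      (∑ p, |Real.log (likelihoodRatio P p + η)|) * ε - mutualInfo P)) := by simp
  rw [← h1, ← hiid.2, ← Finset.sum_sub_distrib]
  refine le_trans ?_ (Finset.sum_le_sum fun m _ => sum_iid_tvDist_le hP hη (c.dec m))
  rw [Finset.sum_comm]
  refine Finset.sum_le_sum fun xs _ => ?_
  have hnn : ∀ m ∈ Finset.univ, 0 ≤ iid (margX P) n xs *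
      (if tvDist (empDist xs (c.dec m)) P ≤ ε then 1 else 0) :=
    fun m _ => mul_nonneg (hiid.1 xs) (by split_ifs <;> norm_num)
  split_ifs with h
  · rw [sub_self]
    exact Finset.sum_nonneg hnn
  · refine le_trans ?_ (Finset.single_le_sum hnn (Finset.mem_univ (c.enc xs)))
    rw [if_pos (show tvDist (empDist xs (c.dec (c.enc xs))) P ≤ ε from not_lt.1 h)]
    simp

/-- Converse: the rate of coordination codes is at least the mutual information. -/
lemma mutualInfo_le_of_tendsto_rate (hP : IsPMF P) {R : ℝ} (c : ∀ n, Code X Y n)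
    (hrate : Tendsto (fun n => (c n).rate) atTop (nhds R)) (htv : TVInProb (margX P) P c) :
    mutualInfo P ≤ R := by
  have key : ∀ η : ℝ, 0 < η → ∀ ε : ℝ, 0 < ε →
      mutualInfo P - η - (∑ p, |Real.log (likelihoodRatio P p + η)|) * ε ≤ R := by
    intro η hη ε hε
    set C := ∑ p, |Real.log (likelihoodRatio P p + η)| with hC
    have hlim : Tendsto (fun n : ℕ => mutualInfo P - η - C * ε - Real.log 2 / n) atTop
        (nhds (mutualInfo P - η - C * ε)) := by
      simpa using (tendsto_const_nhds (x := mutualInfo P - η - C * ε)).sub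
        (tendsto_const_div_atTop_nhds_zero_nat (Real.log 2))
    refine le_of_tendsto_of_tendsto hlim hrate ?_
    filter_upwards [(htv ε hε).eventually (gt_mem_nhds (show (0 : ℝ) < 1 / 2 by norm_num)),
      eventually_gt_atTop 0] with n hn hn0
    have h1 := one_sub_le_code_size_mul hP hη (ε := ε) (c n)
    rw [← hC] at h1
    have hM : (0 : ℝ) < (c n).M := by exact_mod_cast (c n).hM
    have h2 : (1 / 2 : ℝ) ≤ (c n).M * Real.exp (n * (η + C * ε - mutualInfo P)) := by linarith
    have h3 := Real.log_le_log (by norm_num) h2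
    rw [Real.log_mul hM.ne' (Real.exp_pos _).ne', Real.log_exp, one_div, Real.log_inv] at h3
    have hn' : (0 : ℝ) < n := by exact_mod_cast hn0
    rw [Code.rate, sub_le_iff_le_add, ← add_div, le_div_iff₀ hn']
    linarith
  refine le_of_forall_pos_le_add fun η hη => ?_
  have hlim : Tendsto (fun ε : ℝ =>
      mutualInfo P - η - (∑ p, |Real.log (likelihoodRatio P p + η)|) * ε)
      (nhdsWithin 0 (Set.Ioi 0)) (nhds (mutualInfo P - η - 0)) := by
    refine Tendsto.mono_left ?_ nhdsWithin_le_nhds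
    refine Continuous.tendsto' (by fun_prop) _ _ (by simp)
  have := le_of_tendsto hlim (eventually_mem_nhdsWithin.mono fun ε hε => key η hη ε hε)
  linarith

/-- Finite block length achievability, by random coding. -/
lemma exists_code_tvDist_gt_le (hP : IsPMF P) (hfull : ∀ x, 0 < margX P x) {W : X → Y → ℝ}
    (hW : ∀ x, IsPMF (W x)) (hPW : ∀ x y, P (x, y) = margX P x * W x y) {ε : ℝ} (hε : 0 ≤ ε)
    (hε1 : ε ≤ 1) (n : ℕ) {M : ℕ} (hM : 0 < M) :
    ∃ c : Code X Y n, c.M = M ∧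
      ∑ xs : Fin n → X,
        (if ε < tvDist (empDist xs (c.out xs)) P then iid (margX P) n xs else 0) ≤
      Fintype.card (X × Y) * (2 * Real.exp (-(n * ε ^ 2 / (4 * Fintype.card (X × Y) ^ 2)))) +
        Real.exp (-(M / Real.exp (n * (mutualInfo P +
          (∑ p, |Real.log (likelihoodRatio P p)|) * ε)))) := by
  classical
  have hWle : ∀ x y, W x y ≤ Real.exp (Real.log (likelihoodRatio P (x, y))) * margY P y := by
    intro x y
    rcases (hP.1 (x, y)).eq_or_lt with h0 | hpos
    · have hW0 : W x y = 0 := by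
        rw [hPW] at h0
        exact (mul_eq_zero.1 h0.symm).resolve_left (hfull x).ne'
      rw [hW0]
      exact mul_nonneg (Real.exp_pos _).le ((isPMF_margY hP).1 y)
    · have hy : 0 < margY P y := hpos.trans_le (le_margY hP (x, y))
      have hx := hfull x
      rw [Real.exp_log (likelihoodRatio_pos hP hpos), likelihoodRatio, hPW]
      refine le_of_eq ?_
      dsimp only
      field_simp
  have hG : ∀ (xs : Fin n → X) (ys : Fin n → Y), tvDist (empDist xs ys) P ≤ ε →
      ∏ i, W (xs i) (ys i) ≤ Real.exp (n * (mutualInfo P +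
        (∑ p, |Real.log (likelihoodRatio P p)|) * ε)) * ∏ i, margY P (ys i) := by
    intro xs ys h
    refine (Finset.prod_le_prod (fun i _ => (hW _).1 _) fun i _ => hWle (xs i) (ys i)).trans ?_
    rw [Finset.prod_mul_distrib, ← Real.exp_sum]
    refine mul_le_mul_of_nonneg_right (Real.exp_le_exp.2 ?_)
      (Finset.prod_nonneg fun i _ => (isPMF_margY hP).1 _)
    have h1 := (abs_le.1 (abs_sum_letters_sub_le xs ys P
      (fun p => Real.log (likelihoodRatio P p)) h)).2
    rw [mutualInfo_eq_sum, mul_add]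
    linarith
  obtain ⟨b, hb⟩ := exists_codebook (P := iid (margX P) n) (Q := fun ys => ∏ i, margY P (ys i))
    (isPMF_prod fun _ => isPMF_margX hP) (isPMF_prod fun _ => isPMF_margY hP)
    (fun xs : Fin n → X => isPMF_prod fun i => hW (xs i))
    (fun xs ys => tvDist (empDist xs ys) P ≤ ε) (Real.exp_pos _) hG M
  have hsum : ∑ xs : Fin n → X, iid (margX P) n xs * ∑ ys : Fin n → Y,
        (∏ i, W (xs i) (ys i)) * (if tvDist (empDist xs ys) P ≤ ε then 0 else 1) =
      ∑ z : Fin n → X × Y, (∏ i, P (z i)) *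
        (if ε < tvDist (empDist (fun i => (z i).1) (fun i => (z i).2)) P then 1 else 0) := by
    rw [← (Equiv.arrowProdEquivProdArrow (Fin n) (fun _ => X) (fun _ => Y)).symm.sum_comp,
      Fintype.sum_prod_type]
    refine Finset.sum_congr rfl fun xs _ => ?_
    rw [Finset.mul_sum]
    refine Finset.sum_congr rfl fun ys _ => ?_
    have hprod : ∏ i, P (xs i, ys i) = iid (margX P) n xs * ∏ i, W (xs i) (ys i) := by
      rw [iid, ← Finset.prod_mul_distrib]
      exact Finset.prod_congr rfl fun i _ => hPW _ _
    change _ = (∏ i, P (xs i, ys i)) * (if ε < tvDist (empDist xs ys) P then 1 else 0)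
    rw [hprod, mul_assoc]
    congr 2
    by_cases h : tvDist (empDist xs ys) P ≤ ε
    · rw [if_pos h, if_neg (not_lt.2 h)]
    · rw [if_neg h, if_pos (not_le.1 h)]
  rw [hsum] at hb
  refine ⟨⟨M, hM, fun xs => if h : ∃ m, tvDist (empDist xs (b m)) P ≤ ε then h.choose else
    ⟨0, hM⟩, b⟩, rfl, le_trans (Finset.sum_le_sum fun xs _ => ?_)
    (hb.trans (add_le_add_left (sum_words_tvDist_gt_le hP hε hε1 n) _))⟩
  have hnn : 0 ≤ iid (margX P) n xs := (isPMF_prod fun _ => isPMF_margX hP).1 xs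
  by_cases h : ∃ m, tvDist (empDist xs (b m)) P ≤ ε
  · rw [if_neg]
    · exact mul_nonneg hnn (by split_ifs <;> norm_num)
    · simp only [Code.out, dif_pos h]
      exact not_lt.2 h.choose_spec
  · rw [if_pos (not_exists.1 h), mul_one]
    split_ifs
    · exact le_rfl
    · exact hnn

end JointPMF

lemma log_ceil_exp_le {u : ℝ} (hu : 0 ≤ u) : Real.log ⌈Real.exp u⌉₊ ≤ u + Real.log 2 := by
  have h1 := Real.one_le_exp hu
  have h2 := Nat.ceil_lt_add_one (Real.exp_pos u).le
  have h3 : (0 : ℝ) < ⌈Real.exp u⌉₊ := (Real.exp_pos u).trans_le (Nat.le_ceil _)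
  rw [← Real.log_exp u, ← Real.log_mul (Real.exp_pos _).ne' two_ne_zero, Real.log_exp]
  exact Real.log_le_log h3 (by linarith)

lemma tendsto_log_ceil_exp_div {r : ℕ → ℝ} {R : ℝ} (hr : Tendsto r atTop (nhds R))
    (h0 : ∀ n, 0 ≤ r n) :
    Tendsto (fun n : ℕ => Real.log ⌈Real.exp (n * r n)⌉₊ / n) atTop (nhds R) := by
  have hup : Tendsto (fun n : ℕ => r n + Real.log 2 / n) atTop (nhds R) := by
    simpa using hr.add (tendsto_const_div_atTop_nhds_zero_nat (Real.log 2))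
  refine tendsto_of_tendsto_of_tendsto_of_le_of_le' hr hup ?_ ?_ <;>
    filter_upwards [eventually_gt_atTop 0] with n hn
  · have hn' : (0 : ℝ) < n := by exact_mod_cast hn
    rw [le_div_iff₀ hn', mul_comm, Real.le_log_iff_exp_le
      ((Real.exp_pos _).trans_le (Nat.le_ceil _))]
    exact Nat.le_ceil _
  · have hn' : (0 : ℝ) < n := by exact_mod_cast hn
    rw [div_le_iff₀ hn', add_mul, div_mul_cancel₀ _ hn'.ne', mul_comm (r n)]
    exact log_ceil_exp_le (mul_nonneg hn'.le (h0 n))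

/-- Achievability: every rate at least the mutual information is achievable. -/
lemma coordAchievable_of_mutualInfo_le {X Y : Type*} [Fintype X] [Fintype Y] [DecidableEq X]
    [DecidableEq Y] {P : X × Y → ℝ} (hP : IsPMF P) (hfull : ∀ x, 0 < margX P x) {W : X → Y → ℝ}
    (hW : ∀ x, IsPMF (W x)) (hPW : ∀ x y, P (x, y) = margX P x * W x y) {R : ℝ}
    (hR : mutualInfo P ≤ R) : CoordAchievable (margX P) P R := by
  set C := ∑ p, |Real.log (likelihoodRatio P p)| with hC
  have hC0 : 0 ≤ C := Finset.sum_nonneg fun _ _ => abs_nonneg _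
  set k : ℝ := (Fintype.card (X × Y) : ℝ) with hk
  have hne : Nonempty (X × Y) := by
    by_contra hne
    rw [not_nonempty_iff] at hne
    simpa using hP.2
  have hk0 : 0 < k := by rw [hk]; exact_mod_cast Fintype.card_pos
  set a : ℕ → ℝ := fun n => (n : ℝ) ^ (-(1 / 4) : ℝ) with ha
  have ha0 : ∀ n, 0 ≤ a n := fun n => Real.rpow_nonneg n.cast_nonneg _
  have ha1 : ∀ n, a n ≤ 1 := by
    intro n
    rcases Nat.eq_zero_or_pos n with rfl | hn
    · simp only [ha, Nat.cast_zero]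
      rw [Real.zero_rpow (by norm_num)]
      exact zero_le_one
    · exact Real.rpow_le_one_of_one_le_of_nonpos (by exact_mod_cast hn) (by norm_num)
  have halim : Tendsto a atTop (nhds 0) :=
    (tendsto_rpow_neg_atTop (by norm_num)).comp tendsto_natCast_atTop_atTop
  have hna : Tendsto (fun n : ℕ => n * a n) atTop atTop := by
    refine ((tendsto_rpow_atTop (show (0 : ℝ) < 3 / 4 by norm_num)).comp
      tendsto_natCast_atTop_atTop).congr' ?_
    filter_upwards [eventually_gt_atTop 0] with n hn
    have hn' : (0 : ℝ) < n := by exact_mod_cast hn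
    simp only [ha, Function.comp]
    rw [← Real.rpow_one_add' hn'.le (by norm_num)]
    norm_num
  have hna2 : Tendsto (fun n : ℕ => n * a n ^ 2) atTop atTop := by
    refine ((tendsto_rpow_atTop (show (0 : ℝ) < 1 / 2 by norm_num)).comp
      tendsto_natCast_atTop_atTop).congr' ?_
    filter_upwards [eventually_gt_atTop 0] with n hn
    have hn' : (0 : ℝ) < n := by exact_mod_cast hn
    simp only [ha, Function.comp]
    rw [← Real.rpow_mul_natCast hn'.le, ← Real.rpow_one_add' hn'.le (by norm_num)]
    norm_num
  set r : ℕ → ℝ := fun n => R + (C + 1) * a n with hr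
  have hrlim : Tendsto r atTop (nhds R) := by
    simpa using (tendsto_const_nhds (x := R)).add (halim.const_mul (C + 1))
  have hr0 : ∀ n, 0 ≤ r n := fun n =>
    add_nonneg ((mutualInfo_nonneg hP).trans hR) (mul_nonneg (by linarith) (ha0 n))
  choose c hcM hc using fun n => exists_code_tvDist_gt_le hP hfull hW hPW (ha0 n) (ha1 n) n
    (Nat.ceil_pos.2 (Real.exp_pos (n * r n)))
  refine ⟨c, ?_, fun ε hε => ?_⟩
  · simp only [Code.rate, hcM]
    exact tendsto_log_ceil_exp_div hrlim hr0
  have hiid (n : ℕ) : IsPMF (iid (margX P) n) := isPMF_prod fun _ => isPMF_margX hP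
  have hexp : ∀ n : ℕ, Real.exp (-(⌈Real.exp (n * r n)⌉₊ /
      Real.exp (n * (mutualInfo P + C * a n)))) ≤ Real.exp (-(n * a n)) := by
    intro n
    refine Real.exp_le_exp.2 (neg_le_neg ?_)
    rw [le_div_iff₀ (Real.exp_pos _)]
    refine le_trans ?_ (Nat.le_ceil _)
    have h1 : (n : ℝ) * a n ≤ Real.exp (n * a n) := by linarith [Real.add_one_le_exp (n * a n)]
    refine (mul_le_mul_of_nonneg_right h1 (Real.exp_pos _).le).trans ?_
    rw [← Real.exp_add]
    refine Real.exp_le_exp.2 ?_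
    rw [← mul_add]
    refine mul_le_mul_of_nonneg_left ?_ n.cast_nonneg
    simp only [hr]
    linarith
  have hbound : Tendsto (fun n : ℕ => k * (2 * Real.exp (-(n * a n ^ 2 / (4 * k ^ 2)))) +
      Real.exp (-(n * a n))) atTop (nhds 0) := by
    have h1 := Real.tendsto_exp_neg_atTop_nhds_zero.comp
      (hna2.atTop_div_const (show (0 : ℝ) < 4 * k ^ 2 by positivity))
    have h2 := Real.tendsto_exp_neg_atTop_nhds_zero.comp hna
    simpa using ((h1.const_mul 2).const_mul k).add h2
  refine tendsto_of_tendsto_of_tendsto_of_le_of_le' tendsto_const_nhds hbound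
    (Eventually.of_forall fun n => Finset.sum_nonneg fun xs _ => ?_) ?_
  · split_ifs
    · exact (hiid n).1 xs
    · exact le_rfl
  · filter_upwards [halim.eventually (ge_mem_nhds hε)] with n hn
    refine le_trans (Finset.sum_le_sum fun xs _ => ?_)
      ((hc n).trans (add_le_add_right (hexp n) _))
    split_ifs with h1 h2 h2
    · exact le_rfl
    · exact absurd (hn.trans_lt h1) h2
    · exact (hiid n).1 xs
    · exact le_rfl

/-- **Theorem 1 (Cuff–Permuter–Cover).** The pair `(R, P_{Y|X})` is achievable by
coordination codes if and only if `R ≥ I(X;Y)`. -/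
theorem coordination_achievable_iff
    {X Y : Type*} [Fintype X] [Fintype Y] [DecidableEq X] [DecidableEq Y]
    (PX : X → ℝ) (hPX : IsPMF PX) (hPXfull : ∀ x, 0 < PX x)
    (W : X → Y → ℝ) (hW : ∀ x, IsPMF (W x))
    (PXY : X × Y → ℝ) (hPXY : ∀ x y, PXY (x, y) = PX x * W x y)
    (R : ℝ) :
    CoordAchievable PX PXY R ↔ mutualInfo PXY ≤ R := by
  have hmarg : margX PXY = PX := by
    funext x
    simp_rw [margX, hPXY, ← Finset.mul_sum, (hW x).2, mul_one]
  have hP : IsPMF PXY := by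
    refine ⟨fun p => ?_, ?_⟩
    · rw [show p = (p.1, p.2) from rfl, hPXY]
      exact mul_nonneg (hPX.1 _) ((hW _).1 _)
    · rw [Fintype.sum_prod_type, ← hPX.2, ← hmarg]
      rfl
  subst hmarg
  exact ⟨fun ⟨c, hrate, htv⟩ => mutualInfo_le_of_tendsto_rate hP c hrate htv,
    coordAchievable_of_mutualInfo_le hP hPXfull hW hPXY⟩
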